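/- Let Σ be a topologically transitive one-sided Markov shift over the countable alphabet ℤ₊ and A : Σ → ℝ a potential of summable variation. If h_A(x,z) ∈ ℝ (i.e. is finite) for some x, z ∈ Σ, then φ_A(x,y) ∈ ℝ and h_A(x,y) ∈ ℝ for every y ∈ Σ. -/

import Mathlib

open MeasureTheory Filter Set
open scoped ENNReal

namespace CMS

/-- The one-sided Markov shift `Σ` over the countable alphabet `ℕ = ℤ₊`,
determined by the transition matrix `Tr`. -/
abbrev SS (Tr : ℕ → ℕ → Prop) : Type := {x : ℕ → ℕ // ∀ n, Tr (x n) (x (n + 1))}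

/-- The left shift map `σ`. -/
def shiftMap (Tr : ℕ → ℕ → Prop) (x : SS Tr) : SS Tr :=
  ⟨fun n => x.1 (n + 1), fun n => x.2 (n + 1)⟩

open scoped Classical in
/-- The metric `d(x,y) = λ^ℓ`, `ℓ` the first index of disagreement (`0` if `x = y`). -/
noncomputable def sdist (lam : ℝ) {Tr : ℕ → ℕ → Prop} (x y : SS Tr) : ℝ :=
  if h : ∃ n, x.1 n ≠ y.1 n then lam ^ Nat.find h else 0

/-- Birkhoff sum `S_n f`. -/
noncomputable def birk {Tr : ℕ → ℕ → Prop} (f : SS Tr → ℝ) (n : ℕ) (x : SS Tr) : ℝ :=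
  ∑ i ∈ Finset.range n, f ((shiftMap Tr)^[i] x)

/-- `ℓ`-th variation of `f` restricted to a subset `s` (valued in `ℝ≥0∞`). -/
noncomputable def varAtOn (lam : ℝ) {Tr : ℕ → ℕ → Prop} (s : Set (SS Tr))
    (f : SS Tr → ℝ) (ℓ : ℕ) : ℝ≥0∞ :=
  ⨆ (x ∈ s) (y ∈ s) (_ : sdist lam x y ≤ lam ^ ℓ), ENNReal.ofReal (f x - f y)

/-- `ℓ`-th variation `Var_ℓ(f)`. -/
noncomputable def varAt (lam : ℝ) {Tr : ℕ → ℕ → Prop} (f : SS Tr → ℝ) (ℓ : ℕ) : ℝ≥0∞ :=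
  varAtOn lam Set.univ f ℓ

/-- `Var_k^∞(f) = ∑_{ℓ ≥ k} Var_ℓ(f)`. -/
noncomputable def varFrom (lam : ℝ) {Tr : ℕ → ℕ → Prop} (f : SS Tr → ℝ) (k : ℕ) : ℝ≥0∞ :=
  ∑' ℓ : ℕ, varAt lam f (k + ℓ)

/-- `f` has summable variation: `Var_1^∞(f) < ∞`. -/
def SummableVar (lam : ℝ) {Tr : ℕ → ℕ → Prop} (f : SS Tr → ℝ) : Prop :=
  varFrom lam f 1 < ⊤

/-- `f` is locally Hölder continuous: `Var_ℓ(f) ≤ C λ^ℓ` for all `ℓ ≥ 1`. -/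
def LocHolder (lam : ℝ) {Tr : ℕ → ℕ → Prop} (f : SS Tr → ℝ) : Prop :=
  ∃ C : ℝ, 0 < C ∧ ∀ ℓ : ℕ, 1 ≤ ℓ → varAt lam f ℓ ≤ ENNReal.ofReal (C * lam ^ ℓ)

/-- `‖A - B‖_sv = Var_1^∞(A-B) + ‖A-B‖_∞`. -/
noncomputable def svDist (lam : ℝ) {Tr : ℕ → ℕ → Prop} (A B : SS Tr → ℝ) : ℝ≥0∞ :=
  varFrom lam (fun x => A x - B x) 1 + ⨆ x : SS Tr, ENNReal.ofReal |A x - B x|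

/-- `A` is a potential: continuous and bounded from above. -/
def IsPotential {Tr : ℕ → ℕ → Prop} (A : SS Tr → ℝ) : Prop :=
  Continuous A ∧ BddAbove (Set.range A)

/-- Topological transitivity of the shift. -/
def TopTransitive (Tr : ℕ → ℕ → Prop) : Prop :=
  ∀ U V : Set (SS Tr), IsOpen U → IsOpen V → U.Nonempty → V.Nonempty →
    ∃ n : ℕ, ((shiftMap Tr)^[n] '' U ∩ V).Nonempty

/-- The ergodic maximizing constant `β_A`. -/
noncomputable def beta {Tr : ℕ → ℕ → Prop} (A : SS Tr → ℝ) : ℝ :=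
  sSup {r : ℝ | ∃ μ : Measure (SS Tr), IsProbabilityMeasure μ ∧
    μ.map (shiftMap Tr) = μ ∧ r = ∫ x, A x ∂μ}

/-- `μ` is an `A`-maximizing (shift-invariant Borel probability) measure. -/
def Maximizing {Tr : ℕ → ℕ → Prop} (A : SS Tr → ℝ) (μ : Measure (SS Tr)) : Prop :=
  IsProbabilityMeasure μ ∧ μ.map (shiftMap Tr) = μ ∧ ∫ x, A x ∂μ = beta A

/-- Topological support of a measure. -/
def msupport {Tr : ℕ → ℕ → Prop} (μ : Measure (SS Tr)) : Set (SS Tr) :=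
  {x | ∀ U : Set (SS Tr), IsOpen U → x ∈ U → 0 < μ U}

/-- `μ` is the uniform probability measure on a periodic orbit. -/
def PeriodicOrbitMeasure {Tr : ℕ → ℕ → Prop} (μ : Measure (SS Tr)) : Prop :=
  ∃ (y : SS Tr) (p : ℕ), 1 ≤ p ∧ (shiftMap Tr)^[p] y = y ∧
    μ = (p : ℝ≥0∞)⁻¹ • ∑ i ∈ Finset.range p, Measure.dirac ((shiftMap Tr)^[i] y)

/-- `A` is coercive: `lim_{i→∞} sup A|_[i] = -∞`. -/
def Coercive {Tr : ℕ → ℕ → Prop} (A : SS Tr → ℝ) : Prop :=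
  ∀ M : ℝ, ∃ N : ℕ, ∀ i : ℕ, N ≤ i → ∀ x : SS Tr, x.1 0 = i → A x ≤ M

/-- The Aubry set `Ω(A)`. -/
def Aubry (lam : ℝ) {Tr : ℕ → ℕ → Prop} (A : SS Tr → ℝ) : Set (SS Tr) :=
  {x | ∀ ε : ℝ, 0 < ε → ∃ (w : SS Tr) (n : ℕ), 0 < n ∧
    sdist lam x w < ε ∧ sdist lam ((shiftMap Tr)^[n] w) x < ε ∧
    -ε < (n : ℝ) * beta A - birk A n w ∧ (n : ℝ) * beta A - birk A n w < ε}

/-- The auxiliary function `𝔖^k_l(x,y)` at level `γ`. -/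
noncomputable def aux (lam : ℝ) {Tr : ℕ → ℕ → Prop} (A : SS Tr → ℝ) (γ : ℝ)
    (k l : ℕ) (x y : SS Tr) : EReal :=
  ⨅ (n : ℕ) (_ : l ≤ n) (w : SS Tr)
    (_ : sdist lam x w ≤ lam ^ k) (_ : sdist lam ((shiftMap Tr)^[n] w) y ≤ lam ^ k),
    (((n : ℝ) * γ - birk A n w : ℝ) : EReal)

/-- The Mañé potential `φ^γ_A(x,y)`. -/
noncomputable def mane (lam : ℝ) {Tr : ℕ → ℕ → Prop} (A : SS Tr → ℝ) (γ : ℝ)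
    (x y : SS Tr) : EReal :=
  ⨆ k : ℕ, aux lam A γ k 1 x y

/-- The Peierls barrier `h^γ_A(x,y)`. -/
noncomputable def peierls (lam : ℝ) {Tr : ℕ → ℕ → Prop} (A : SS Tr → ℝ) (γ : ℝ)
    (x y : SS Tr) : EReal :=
  ⨆ (k : ℕ) (l : ℕ), aux lam A γ k (l + 1) x y

lemma shiftMap_iterate_apply {Tr : ℕ → ℕ → Prop} (m : ℕ) (x : SS Tr) (i : ℕ) :
    ((shiftMap Tr)^[m] x).1 i = x.1 (i + m) := by
  induction m generalizing x with
  | zero => rfl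
  | succ m ih =>
    rw [Function.iterate_succ_apply, ih]
    rfl

lemma sdist_le_pow_iff {lam : ℝ} (h0 : 0 < lam) (h1 : lam < 1) {Tr : ℕ → ℕ → Prop}
    (x y : SS Tr) (k : ℕ) : sdist lam x y ≤ lam ^ k ↔ ∀ i < k, x.1 i = y.1 i := by
  classical
  unfold sdist
  split_ifs with h
  · rw [pow_le_pow_iff_right_of_lt_one₀ h0 h1, Nat.le_find_iff]
    simp
  · push Not at h
    simp [h, h0.le]

lemma birk_succ_left {Tr : ℕ → ℕ → Prop} (f : SS Tr → ℝ) (n : ℕ) (x : SS Tr) :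
    birk f (n + 1) x = f x + birk f n (shiftMap Tr x) := by
  simp [birk, Finset.sum_range_succ', add_comm]

lemma birk_add {Tr : ℕ → ℕ → Prop} (f : SS Tr → ℝ) (n m : ℕ) (x : SS Tr) :
    birk f (n + m) x = birk f n x + birk f m ((shiftMap Tr)^[n] x) := by
  simp [birk, Finset.sum_range_add, ← Function.iterate_add_apply, add_comm]

/-- Bounded distortion: Birkhoff sums of length `n` of points sharing their first `n` symbols
differ by a uniformly bounded amount. -/
lemma SummableVar.exists_birk_le {lam : ℝ} (h0 : 0 < lam) (h1 : lam < 1) {Tr : ℕ → ℕ → Prop}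
    {A : SS Tr → ℝ} (hA : SummableVar lam A) :
    ∃ V : ℝ, ∀ (n : ℕ) (a b : SS Tr), (∀ i < n, a.1 i = b.1 i) →
      birk A n a ≤ birk A n b + V := by
  have hne : ∑' ℓ : ℕ, varAt lam A (1 + ℓ) ≠ ⊤ := hA.ne
  have key : ∀ (n : ℕ) (a b : SS Tr), (∀ i < n, a.1 i = b.1 i) →
      birk A n a ≤ birk A n b + ∑ j ∈ Finset.range n, (varAt lam A (1 + j)).toReal := by
    intro n
    induction n with
    | zero => intro a b _; simp [birk]
    | succ n ih =>
      intro a b hab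
      have hs := ih (shiftMap Tr a) (shiftMap Tr b) fun i hi => hab (i + 1) (by omega)
      have hd : ENNReal.ofReal (A a - A b) ≤ varAt lam A (1 + n) := by
        have hab' : sdist lam a b ≤ lam ^ (1 + n) :=
          (sdist_le_pow_iff h0 h1 a b _).2 fun i hi => hab i (by omega)
        unfold varAt varAtOn
        exact le_iSup₂_of_le a (mem_univ a) <| le_iSup₂_of_le b (mem_univ b) <|
          le_iSup_of_le hab' le_rfl
      have hd' := (ENNReal.ofReal_le_iff_le_toReal
        (ENNReal.ne_top_of_tsum_ne_top hne n)).1 hd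
      rw [birk_succ_left, birk_succ_left, Finset.sum_range_succ]
      linarith
  refine ⟨∑' j : ℕ, (varAt lam A (1 + j)).toReal, fun n a b hab => (key n a b hab).trans ?_⟩
  gcongr
  exact (ENNReal.summable_toReal hne).sum_le_tsum _ fun _ _ => ENNReal.toReal_nonneg

lemma measurable_shiftMap (Tr : ℕ → ℕ → Prop) : Measurable (shiftMap Tr) :=
  Measurable.subtype_mk (f := fun x : SS Tr => fun n => x.1 (n + 1)) <|
    measurable_pi_lambda _ fun n => (measurable_pi_apply (n + 1)).comp measurable_subtype_coe

lemma bddAbove_integral_invariant {Tr : ℕ → ℕ → Prop} {A : SS Tr → ℝ}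
    (hA : BddAbove (range A)) :
    BddAbove {r : ℝ | ∃ μ : Measure (SS Tr), IsProbabilityMeasure μ ∧
      μ.map (shiftMap Tr) = μ ∧ r = ∫ x, A x ∂μ} := by
  obtain ⟨M, hM⟩ := hA
  refine ⟨max M 0, ?_⟩
  rintro r ⟨μ, hμ, -, rfl⟩
  by_cases hi : Integrable A μ
  · calc ∫ x, A x ∂μ ≤ ∫ _, M ∂μ :=
          integral_mono hi (integrable_const M) fun x => hM (mem_range_self x)
      _ = M := by simp
      _ ≤ max M 0 := le_max_left _ _
  · rw [integral_undef hi]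
    exact le_max_right _ _

lemma birk_le_mul_beta_of_periodic {Tr : ℕ → ℕ → Prop} {A : SS Tr → ℝ}
    (hA : BddAbove (range A)) {N : ℕ} (hN : 0 < N) {p : SS Tr}
    (hp : (shiftMap Tr)^[N] p = p) : birk A N p ≤ N * beta A := by
  have hN' : (N : ℝ≥0∞) ≠ 0 := by exact_mod_cast hN.ne'
  set μ : Measure (SS Tr) :=
    (N : ℝ≥0∞)⁻¹ • ∑ i ∈ Finset.range N, Measure.dirac ((shiftMap Tr)^[i] p) with hμ
  have hprob : IsProbabilityMeasure μ := ⟨by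
    simp [hμ, Measure.finsetSum_apply, ENNReal.inv_mul_cancel hN' (ENNReal.natCast_ne_top N)]⟩
  have hinv : μ.map (shiftMap Tr) = μ := by
    have hsum : ∑ i ∈ Finset.range N, Measure.dirac ((shiftMap Tr)^[i + 1] p) =
        ∑ i ∈ Finset.range N, Measure.dirac ((shiftMap Tr)^[i] p) := by
      obtain ⟨M, rfl⟩ := Nat.exists_eq_add_of_lt hN
      rw [Finset.sum_range_succ, Finset.sum_range_succ']
      simp only [zero_add] at hp ⊢
      rw [hp]
      rfl
    rw [hμ, Measure.map_smul, ← Measure.mapₗ_apply_of_measurable (measurable_shiftMap Tr),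
      map_sum, ← hsum]
    congr 1
    refine Finset.sum_congr rfl fun i _ => ?_
    rw [Measure.mapₗ_apply_of_measurable (measurable_shiftMap Tr),
      Measure.map_dirac' (measurable_shiftMap Tr), Function.iterate_succ_apply']
  have hAμ : ∫ x, A x ∂μ = (N : ℝ)⁻¹ * birk A N p := by
    rw [hμ, integral_smul_measure, integral_finsetSum_measure fun i _ =>
      integrable_dirac (by simp)]
    simp [birk]
  have hle : (N : ℝ)⁻¹ * birk A N p ≤ beta A :=
    le_csSup (bddAbove_integral_invariant hA) ⟨μ, hprob, hinv, hAμ.symm⟩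
  have hNr : (0 : ℝ) < N := by exact_mod_cast hN
  rwa [inv_mul_le_iff₀ hNr] at hle

/-- The periodic point repeating the first `N` symbols of `v`. -/
def periodize {Tr : ℕ → ℕ → Prop} (v : SS Tr) (N : ℕ) (hN : 0 < N) (h : v.1 N = v.1 0) :
    SS Tr :=
  ⟨fun i => v.1 (i % N), fun i => by
    have hlt := Nat.mod_lt i hN
    have hv := v.2 (i % N)
    dsimp only
    rw [Nat.add_mod_eq_ite]
    rcases Nat.lt_or_ge 1 N with h1 | h1
    · rw [Nat.mod_eq_of_lt h1]
      split_ifs with hge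
      · have heq : i % N + 1 = N := by omega
        rw [heq, h] at hv
        simpa [heq] using hv
      · exact hv
    · obtain rfl : N = 1 := by omega
      simp only [Nat.mod_one] at hv ⊢
      simpa [h] using hv⟩

/-- The point following `w` for its first `n` symbols and then `v`. -/
def concat {Tr : ℕ → ℕ → Prop} (w : SS Tr) (n : ℕ) (v : SS Tr) (h : w.1 n = v.1 0) : SS Tr :=
  ⟨fun i => if i < n then w.1 i else v.1 (i - n), fun i => by
    by_cases h1 : i + 1 < n
    · simpa [h1, (by omega : i < n)] using w.2 i
    · by_cases h2 : i < n
      · obtain rfl : n = i + 1 := by omega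
        simpa [← h] using w.2 i
      · simpa [h1, h2, (by omega : i + 1 - n = i - n + 1)] using v.2 (i - n)⟩

lemma concat_apply_of_lt {Tr : ℕ → ℕ → Prop} {w v : SS Tr} {n : ℕ} (h : w.1 n = v.1 0)
    {i : ℕ} (hi : i < n) : (concat w n v h).1 i = w.1 i :=
  if_pos hi

lemma shiftMap_iterate_concat {Tr : ℕ → ℕ → Prop} {w v : SS Tr} {n : ℕ} (h : w.1 n = v.1 0) :
    (shiftMap Tr)^[n] (concat w n v h) = v := by
  ext i
  simp [shiftMap_iterate_apply, concat]

lemma birk_concat {Tr : ℕ → ℕ → Prop} (f : SS Tr → ℝ) {w v : SS Tr} {n : ℕ}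
    (h : w.1 n = v.1 0) (m : ℕ) :
    birk f (n + m) (concat w n v h) = birk f n (concat w n v h) + birk f m v := by
  rw [birk_add, shiftMap_iterate_concat]

lemma isOpen_firstSymbol (Tr : ℕ → ℕ → Prop) (a : ℕ) : IsOpen {x : SS Tr | x.1 0 = a} :=
  have hcont : Continuous fun x : SS Tr => x.1 0 :=
    (continuous_apply 0).comp continuous_subtype_val
  (isOpen_discrete {a}).preimage hcont

lemma TopTransitive.exists_path {Tr : ℕ → ℕ → Prop} (htr : TopTransitive Tr) (x y : SS Tr) :
    ∃ (m : ℕ) (u : SS Tr), u.1 0 = x.1 0 ∧ u.1 m = y.1 0 := by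
  obtain ⟨m, _, ⟨u, hu, rfl⟩, hv⟩ := htr {u | u.1 0 = x.1 0} {v | v.1 0 = y.1 0}
    (isOpen_firstSymbol Tr _) (isOpen_firstSymbol Tr _) ⟨x, rfl⟩ ⟨y, rfl⟩
  refine ⟨m, u, hu, ?_⟩
  simpa [shiftMap_iterate_apply] using hv

/-- If Birkhoff sums have bounded distortion, those along words returning to their first symbol
are bounded by `N * beta A` up to a constant. -/
lemma birk_le_of_loop {Tr : ℕ → ℕ → Prop} {A : SS Tr → ℝ} (hA : BddAbove (range A)) {V : ℝ}
    (hV : ∀ (n : ℕ) (a b : SS Tr), (∀ i < n, a.1 i = b.1 i) → birk A n a ≤ birk A n b + V)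
    {N : ℕ} (hN : 0 < N) {v : SS Tr} (h : v.1 N = v.1 0) :
    birk A N v ≤ N * beta A + V := by
  have hper : (shiftMap Tr)^[N] (periodize v N hN h) = periodize v N hN h := by
    ext i
    simp [shiftMap_iterate_apply, periodize]
  have h1 := birk_le_mul_beta_of_periodic hA hN hper
  have h2 := hV N v (periodize v N hN h) fun i hi => by
    simp [periodize, Nat.mod_eq_of_lt hi]
  linarith

lemma bot_lt_mane {lam : ℝ} (h0 : 0 < lam) (h1 : lam < 1) {Tr : ℕ → ℕ → Prop}
    (htr : TopTransitive Tr) {A : SS Tr → ℝ} (hA : BddAbove (range A))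
    (hAsv : SummableVar lam A) (x y : SS Tr) : ⊥ < mane lam A (beta A) x y := by
  obtain ⟨V, hV⟩ := hAsv.exists_birk_le h0 h1
  obtain ⟨m, u, hu0, hum⟩ := htr.exists_path y x
  have hbound : ((birk A m u - m * beta A - 2 * V : ℝ) : EReal) ≤
      aux lam A (beta A) 1 1 x y := by
    refine le_iInf fun n => le_iInf fun hn => le_iInf fun w => le_iInf fun hw =>
      le_iInf fun hy => EReal.coe_le_coe_iff.2 ?_
    have hw0 := (sdist_le_pow_iff h0 h1 _ _ _).1 hw 0 one_pos
    have hwn := (sdist_le_pow_iff h0 h1 _ _ _).1 hy 0 one_pos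
    rw [shiftMap_iterate_apply, zero_add] at hwn
    have hj : w.1 n = u.1 0 := hwn.trans hu0.symm
    have hloop : (concat w n u hj).1 (n + m) = (concat w n u hj).1 0 := by
      rw [concat_apply_of_lt hj (i := 0) (by omega), ← hw0, ← hum]
      simp [concat]
    have e1 := birk_le_of_loop hA hV (by omega : 0 < n + m) hloop
    rw [birk_concat] at e1
    have e2 := hV n w (concat w n u hj) fun i hi => (concat_apply_of_lt hj hi).symm
    push_cast at e1
    linarith
  exact (EReal.bot_lt_coe _).trans_le
    (hbound.trans (le_iSup (fun k => aux lam A (beta A) k 1 x y) 1))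

lemma mane_le_peierls (lam : ℝ) {Tr : ℕ → ℕ → Prop} (A : SS Tr → ℝ) (γ : ℝ) (x y : SS Tr) :
    mane lam A γ x y ≤ peierls lam A γ x y :=
  iSup_mono fun k => le_iSup (fun l => aux lam A γ k (l + 1) x y) 0

lemma peierls_lt_top {lam : ℝ} (h0 : 0 < lam) (h1 : lam < 1) {Tr : ℕ → ℕ → Prop}
    (htr : TopTransitive Tr) {A : SS Tr → ℝ} (hAsv : SummableVar lam A) {γ : ℝ}
    {x z : SS Tr} (hz : peierls lam A γ x z < ⊤) (y : SS Tr) :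
    peierls lam A γ x y < ⊤ := by
  obtain ⟨V, hV⟩ := hAsv.exists_birk_le h0 h1
  obtain ⟨m, u, hu0, hum⟩ := htr.exists_path z y
  obtain ⟨C, hC, -⟩ := EReal.lt_iff_exists_real_btwn.1 hz
  refine lt_of_le_of_lt (b := ((C + m * γ - birk A m u + 2 * V : ℝ) : EReal)) ?_
    (EReal.coe_lt_top _)
  refine iSup_le fun k => iSup_le fun l => ?_
  have hlt : aux lam A γ (k + 1) (k + l + 1) x z < C :=
    (le_iSup₂ (f := fun k l => aux lam A γ k (l + 1) x z) (k + 1) (k + l)).trans_lt hC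
  simp only [aux, iInf_lt_iff, EReal.coe_lt_coe_iff] at hlt
  obtain ⟨n, hn, w, hw, hwz, hcost⟩ := hlt
  have hwz0 := (sdist_le_pow_iff h0 h1 _ _ _).1 hwz 0 k.succ_pos
  rw [shiftMap_iterate_apply, zero_add] at hwz0
  set v := concat u m y hum with hv
  have hv0 : v.1 0 = u.1 0 := by
    rcases m.eq_zero_or_pos with rfl | hm
    · simpa [hv, concat] using hum.symm
    · exact concat_apply_of_lt hum hm
  have hj : w.1 n = v.1 0 := by rw [hwz0, hv0, hu0]
  have hshift : (shiftMap Tr)^[n + m] (concat w n v hj) = y := by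
    rw [add_comm, Function.iterate_add_apply, shiftMap_iterate_concat, hv,
      shiftMap_iterate_concat]
  refine iInf₂_le_of_le (n + m) (by omega) <| iInf₂_le_of_le (concat w n v hj) ?_ <|
    iInf_le_of_le ?_ <| EReal.coe_le_coe_iff.2 ?_
  · refine (sdist_le_pow_iff h0 h1 _ _ _).2 fun i hi => ?_
    rw [concat_apply_of_lt hj (by omega)]
    exact (sdist_le_pow_iff h0 h1 _ _ _).1 hw i (by omega)
  · rw [hshift]
    exact (sdist_le_pow_iff h0 h1 _ _ _).2 fun _ _ => rfl
  · have e1 := hV n w (concat w n v hj) fun i hi => (concat_apply_of_lt hj hi).symm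
    have e2 := hV m u v fun i hi => (concat_apply_of_lt hum hi).symm
    rw [birk_concat]
    push_cast
    linarith

theorem mane_peierls_real_valued
    (lam : ℝ) (hlam0 : 0 < lam) (hlam1 : lam < 1)
    (Tr : ℕ → ℕ → Prop) (htr : TopTransitive Tr)
    (A : SS Tr → ℝ) (hA : IsPotential A) (hAsv : SummableVar lam A)
    (x z : SS Tr) (hfin : ∃ r : ℝ, peierls lam A (beta A) x z = (r : EReal)) :
    ∀ y : SS Tr, (∃ r : ℝ, mane lam A (beta A) x y = (r : EReal)) ∧
      (∃ r : ℝ, peierls lam A (beta A) x y = (r : EReal)) := by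
  intro y
  obtain ⟨r, hr⟩ := hfin
  have hlow := bot_lt_mane hlam0 hlam1 htr hA.2 hAsv x y
  have hmid := mane_le_peierls lam A (beta A) x y
  have hup := peierls_lt_top hlam0 hlam1 htr hAsv (hr ▸ EReal.coe_lt_top r) y
  exact ⟨⟨_, (EReal.coe_toReal (hmid.trans_lt hup).ne hlow.ne').symm⟩,
    ⟨_, (EReal.coe_toReal hup.ne (hlow.trans_le hmid).ne').symm⟩⟩

end CMS
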